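/- With H, K, Γ, A as above, Ind_Γ(A) equals the closure of [ΓAΓ*] in the topology τ_Γ on L(K) generated by the seminorms T ↦ ‖Tγ‖ and T ↦ ‖T*γ‖ for γ ∈ Γ. -/

import Mathlib

noncomputable section
open ContinuousLinearMap

/-- Closed linear span of a subset of a complex normed space. -/
def clspan {E : Type*} [NormedAddCommGroup E] [NormedSpace ℂ E] (S : Set E) : Set E :=
  ((Submodule.span ℂ S).topologicalClosure : Set E)

section ClosedSpan

variable {E F : Type*} [NormedAddCommGroup E] [NormedSpace ℂ E]
  [NormedAddCommGroup F] [NormedSpace ℂ F]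

lemma subset_clspan (S : Set E) : S ⊆ clspan S := fun _ hx =>
  (Submodule.span ℂ S).le_topologicalClosure (Submodule.subset_span hx)

lemma isClosed_clspan (S : Set E) : IsClosed (clspan S) :=
  (Submodule.span ℂ S).isClosed_topologicalClosure

lemma map_mem_clspan {σ : ℂ →+* ℂ} (f : E →SL[σ] F) {S : Set E} {W : Set F}
    (h : ∀ s ∈ S, f s ∈ clspan W) {x : E} (hx : x ∈ clspan S) : f x ∈ clspan W := by
  have hle : (Submodule.span ℂ S).topologicalClosure ≤
      (Submodule.span ℂ W).topologicalClosure.comap (f : E →ₛₗ[σ] F) :=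
    Submodule.topologicalClosure_minimal _ (Submodule.span_le.2 h)
      ((isClosed_clspan W).preimage f.continuous)
  exact hle hx

lemma tendsto_of_mem_clspan {ι : Type*} {l : Filter ι} {e : ι → E →L[ℂ] E}
    (he : ∀ᶠ i in l, ‖e i‖ ≤ 1) {S : Set E}
    (h : ∀ s ∈ S, Filter.Tendsto (fun i => e i s) l (nhds s)) {x : E} (hx : x ∈ clspan S) :
    Filter.Tendsto (fun i => e i x) l (nhds x) := by
  have hspan : ∀ y ∈ Submodule.span ℂ S, Filter.Tendsto (fun i => e i y) l (nhds y) := by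
    intro y hy
    induction hy using Submodule.span_induction with
    | mem y hy => exact h y hy
    | zero => simpa using tendsto_const_nhds
    | add y z _ _ hy hz => simpa using hy.add hz
    | smul c y _ hy => simpa using hy.const_smul c
  rw [Metric.tendsto_nhds]
  intro ε hε
  obtain ⟨y, hy, hxy⟩ := Metric.mem_closure_iff.1 hx (ε / 3) (by positivity)
  filter_upwards [he, Metric.tendsto_nhds.1 (hspan y hy) (ε / 3) (by positivity)] with i hi hiy
  have h1 : dist (e i x) (e i y) ≤ dist x y := by
    rw [dist_eq_norm, dist_eq_norm, ← map_sub]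
    simpa using (e i).le_of_opNorm_le hi (x - y)
  have h2 := dist_triangle4 (e i x) (e i y) y x
  rw [dist_comm y x] at h2
  linarith

end ClosedSpan

section Composition

variable {E F G : Type*} [NormedAddCommGroup E] [NormedSpace ℂ E]
  [NormedAddCommGroup F] [NormedSpace ℂ F] [NormedAddCommGroup G] [NormedSpace ℂ G]

lemma comp_mem_clspan {S : Set (F →L[ℂ] G)} {T : Set (E →L[ℂ] F)} {W : Set (E →L[ℂ] G)}
    (h : ∀ s ∈ S, ∀ t ∈ T, s ∘L t ∈ clspan W) {x : F →L[ℂ] G} (hx : x ∈ clspan S)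
    {y : E →L[ℂ] F} (hy : y ∈ clspan T) : x ∘L y ∈ clspan W :=
  map_mem_clspan ((compL ℂ E F G).flip y)
    (fun s hs => map_mem_clspan (compL ℂ E F G s) (h s hs) hy) hx

lemma clspan_comp_mem {S : Set (F →L[ℂ] G)} {W : Set (E →L[ℂ] G)} {y : E →L[ℂ] F}
    (h : ∀ s ∈ S, s ∘L y ∈ clspan W) {x : F →L[ℂ] G} (hx : x ∈ clspan S) :
    x ∘L y ∈ clspan W :=
  map_mem_clspan ((compL ℂ E F G).flip y) h hx

lemma comp_clspan_mem {T : Set (E →L[ℂ] F)} {W : Set (E →L[ℂ] G)} {x : F →L[ℂ] G}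
    (h : ∀ t ∈ T, x ∘L t ∈ clspan W) {y : E →L[ℂ] F} (hy : y ∈ clspan T) :
    x ∘L y ∈ clspan W :=
  map_mem_clspan (compL ℂ E F G x) h hy

end Composition

lemma adjoint_mem_clspan {H K : Type*} [NormedAddCommGroup H] [InnerProductSpace ℂ H]
    [CompleteSpace H] [NormedAddCommGroup K] [InnerProductSpace ℂ K] [CompleteSpace K]
    {S : Set (H →L[ℂ] K)} {W : Set (K →L[ℂ] H)} (h : ∀ s ∈ S, adjoint s ∈ clspan W)
    {x : H →L[ℂ] K} (hx : x ∈ clspan S) : adjoint x ∈ clspan W :=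
  map_mem_clspan
    ((adjoint : (H →L[ℂ] K) ≃ₗᵢ⋆[ℂ] (K →L[ℂ] H)).toContinuousLinearEquiv :
      (H →L[ℂ] K) →SL[starRingEnd ℂ] (K →L[ℂ] H)) h hx

lemma NonUnitalStarSubalgebra.exists_approximateUnit {R : Type*} [NonUnitalCStarAlgebra R]
    (B : NonUnitalStarSubalgebra ℂ R) (hB : IsClosed (B : Set R)) :
    ∃ l : Filter R, l.NeBot ∧ (∀ᶠ e in l, e ∈ B) ∧ (∀ᶠ e in l, ‖e‖ ≤ 1) ∧
      (∀ᶠ e in l, star e = e) ∧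
      ∀ b ∈ B, Filter.Tendsto (fun e => e * b) l (nhds b) := by
  have : IsClosed (B : Set R) := hB
  let _ : NonUnitalCStarAlgebra B := NonUnitalStarSubalgebra.nonUnitalCStarAlgebra B
  let _ := CStarAlgebra.spectralOrder B
  have := CStarAlgebra.spectralOrderedRing B
  have hu := CStarAlgebra.increasingApproximateUnit B
  have := hu.neBot
  refine ⟨(CStarAlgebra.approximateUnit B).map Subtype.val, inferInstance, ?_, ?_, ?_, ?_⟩
  · exact Filter.eventually_map.2 (.of_forall fun e => e.2)
  · exact Filter.eventually_map.2 hu.eventually_norm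
  · exact Filter.eventually_map.2 (hu.eventually_star_eq.mono fun e he => congrArg Subtype.val he)
  · intro b hb
    exact Filter.tendsto_map'_iff.2
      ((continuous_subtype_val.tendsto _).comp (hu.tendsto_mul_right ⟨b, hb⟩))

/-- With `Γ ⊆ L(H,K)` a concrete C*-module with `[ΓH]=K` and `A ⊆ L(H)` a
nondegenerate C*-algebra with `[A𝔅] ⊆ A`, `Ind_Γ(A)` equals the closure of the linear
span of `ΓAΓ*` in the topology `τ_Γ` generated by the seminorms `T ↦ ‖Tγ‖`, `T ↦ ‖T*γ‖`
(`γ ∈ Γ`); i.e. `T ∈ Ind_Γ(A)` iff for every `ε > 0` and finite `F ⊆ Γ` there is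
`S ∈ span(ΓAΓ*)` with `‖(T-S)γ‖ < ε` and `‖(T-S)*γ‖ < ε` for all `γ ∈ F`. -/
theorem stmt14
    {H K : Type*} [NormedAddCommGroup H] [InnerProductSpace ℂ H] [CompleteSpace H]
    [NormedAddCommGroup K] [InnerProductSpace ℂ K] [CompleteSpace K]
    (Γ : Set (H →L[ℂ] K))
    (hΓclosed : clspan Γ = Γ)
    (hΓ : clspan (Set.image2 (fun (S : K →L[ℂ] K) (T : H →L[ℂ] K) => S ∘L T)
        (Set.image2 (fun (S T : H →L[ℂ] K) => S ∘L adjoint T) Γ Γ) Γ) = Γ)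
    (hΓH : (Submodule.span ℂ {x : K | ∃ γ ∈ Γ, ∃ ζ : H, γ ζ = x}).topologicalClosure = ⊤)
    (A : Set (H →L[ℂ] H))
    (hAclosed : clspan A = A) (hAmul : ∀ a ∈ A, ∀ a' ∈ A, a ∘L a' ∈ A)
    (hAstar : ∀ a ∈ A, adjoint a ∈ A)
    (hAnd : (Submodule.span ℂ {x : H | ∃ a ∈ A, ∃ ζ : H, a ζ = x}).topologicalClosure = ⊤)
    (hA𝔅 : clspan (Set.image2 (fun (a b : H →L[ℂ] H) => a ∘L b) A
        (clspan (Set.image2 (fun (S T : H →L[ℂ] K) => adjoint S ∘L T) Γ Γ))) ⊆ A) :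
    {T : K →L[ℂ] K |
        (∀ γ ∈ Γ, T ∘L γ ∈
          clspan (Set.image2 (fun (γ' : H →L[ℂ] K) (a : H →L[ℂ] H) => γ' ∘L a) Γ A)) ∧
        (∀ γ ∈ Γ, adjoint T ∘L γ ∈
          clspan (Set.image2 (fun (γ' : H →L[ℂ] K) (a : H →L[ℂ] H) => γ' ∘L a) Γ A))}
      =
    {T : K →L[ℂ] K | ∀ ε > (0:ℝ), ∀ F : Finset (H →L[ℂ] K), ↑F ⊆ Γ →
        ∃ S ∈ Submodule.span ℂ (Set.image2
            (fun (x : H →L[ℂ] K) (y : K →L[ℂ] H) => x ∘L y)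
            (Set.image2 (fun (γ : H →L[ℂ] K) (a : H →L[ℂ] H) => γ ∘L a) Γ A)
            ((fun γ : H →L[ℂ] K => adjoint γ) '' Γ)),
          ∀ γ ∈ F, ‖(T - S) ∘L γ‖ < ε ∧ ‖adjoint (T - S) ∘L γ‖ < ε} := by
  have hΓ3 : ∀ x ∈ Γ, ∀ y ∈ Γ, ∀ z ∈ Γ, (x ∘L adjoint y) ∘L z ∈ Γ := fun x hx y hy z hz => by
    rw [← hΓ]
    exact subset_clspan _ ⟨_, ⟨x, hx, y, hy, rfl⟩, z, hz, rfl⟩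
  have hA3 : ∀ a ∈ A, ∀ x ∈ Γ, ∀ y ∈ Γ, a ∘L (adjoint x ∘L y) ∈ A := fun a ha x hx y hy =>
    hA𝔅 (subset_clspan _ ⟨a, ha, _, subset_clspan _ ⟨x, hx, y, hy, rfl⟩, rfl⟩)
  set ΓA := Set.image2 (fun (γ : H →L[ℂ] K) (a : H →L[ℂ] H) => γ ∘L a) Γ A with hΓA
  set W := Set.image2 (fun (x : H →L[ℂ] K) (y : K →L[ℂ] H) => x ∘L y) ΓA
    ((fun γ : H →L[ℂ] K => adjoint γ) '' Γ) with hW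
  set P := Set.image2 (fun (S T : H →L[ℂ] K) => S ∘L adjoint T) Γ Γ with hP
  ext T
  simp only [Set.mem_ofPred_eq]
  constructor
  · rintro ⟨hT, hT'⟩ ε hε F hF
    let B : NonUnitalStarSubalgebra ℂ (K →L[ℂ] K) :=
      { (Submodule.span ℂ P).topologicalClosure with
        mul_mem' := fun {a b} ha hb => by
          refine comp_mem_clspan (S := P) (T := P) (W := P) ?_ ha hb
          rintro _ ⟨x, hx, y, hy, rfl⟩ _ ⟨z, hz, w, hw, rfl⟩
          exact subset_clspan _ ⟨_, hΓ3 x hx y hy z hz, w, hw, rfl⟩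
        star_mem' := fun {a} ha => by
          refine adjoint_mem_clspan (S := P) (W := P) ?_ ha
          rintro _ ⟨x, hx, y, hy, rfl⟩
          exact subset_clspan _ ⟨y, hy, x, hx, by simp [adjoint_comp]⟩ }
    obtain ⟨l, _, hlB, hl1, hlstar, hlu⟩ := B.exists_approximateUnit (isClosed_clspan P)
    have hl1' : ∀ᶠ e in l, ‖compL ℂ H K K e‖ ≤ 1 := hl1.mono fun e he =>
      opNorm_le_bound _ zero_le_one fun x =>
        (opNorm_comp_le e x).trans (mul_le_mul_of_nonneg_right he (norm_nonneg x))
    have hlΓ : ∀ γ ∈ Γ, Filter.Tendsto (fun e => e ∘L γ) l (nhds γ) := by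
      intro γ hγ
      rw [← hΓ] at hγ
      refine tendsto_of_mem_clspan (e := fun e => compL ℂ H K K e) hl1' ?_ hγ
      rintro _ ⟨b, hb, γ', -, rfl⟩
      exact (((compL ℂ H K K).flip γ').continuous.tendsto b).comp (hlu b (subset_clspan P hb))
    have hlΓA : ∀ x ∈ clspan ΓA, Filter.Tendsto (fun e => e ∘L x) l (nhds x) := by
      intro x hx
      refine tendsto_of_mem_clspan (e := fun e => compL ℂ H K K e) hl1' ?_ hx
      rintro _ ⟨γ, hγ, a, -, rfl⟩
      exact (((compL ℂ H H K).flip a).continuous.tendsto γ).comp (hlΓ γ hγ)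
    have key : ∀ R : K →L[ℂ] K, ∀ γ ∈ Γ, R ∘L γ ∈ clspan ΓA →
        ∀ᶠ e in l, ‖(R - e ∘L R ∘L e) ∘L γ‖ < ε := by
      intro R γ hγ hR
      have h1 : Filter.Tendsto
          (fun e : K →L[ℂ] K => ‖R ∘L γ - e ∘L (R ∘L γ)‖ + ‖R ∘L γ - R ∘L (e ∘L γ)‖)
          l (nhds 0) := by
        have ha := (tendsto_const_nhds (x := R ∘L γ)).sub (hlΓA _ hR)
        have hb := (tendsto_const_nhds (x := R ∘L γ)).sub
          (((compL ℂ H K K R).continuous.tendsto γ).comp (hlΓ γ hγ))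
        simpa using ha.norm.add hb.norm
      filter_upwards [hl1, h1.eventually (gt_mem_nhds hε)] with e he hlt
      refine lt_of_le_of_lt ?_ hlt
      have heq : (R - e ∘L R ∘L e) ∘L γ =
          (R ∘L γ - e ∘L (R ∘L γ)) + e ∘L (R ∘L γ - R ∘L (e ∘L γ)) := by
        ext; simp
      rw [heq]
      refine (norm_add_le _ _).trans (add_le_add_right ((opNorm_comp_le _ _).trans ?_) _)
      exact mul_le_of_le_one_left (norm_nonneg _) he
    have hall : ∀ᶠ e in l, ∀ γ ∈ F, ‖(T - e ∘L T ∘L e) ∘L γ‖ < ε ∧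
        ‖(adjoint T - e ∘L adjoint T ∘L e) ∘L γ‖ < ε :=
      (Filter.eventually_all_finset F).2 fun γ hγ =>
        (key T γ (hF hγ) (hT γ (hF hγ))).and (key (adjoint T) γ (hF hγ) (hT' γ (hF hγ)))
    obtain ⟨e, heB, hestar, he⟩ := (hlB.and (hlstar.and hall)).exists
    have hadj : adjoint e = e := hestar
    have heW : e ∘L T ∘L e ∈ clspan W := by
      refine comp_mem_clspan (S := P) (T := W) ?_ heB ?_
      · rintro _ ⟨x, hx, y, hy, rfl⟩ _ ⟨_, ⟨z, hz, a, ha, rfl⟩, _, ⟨w, hw, rfl⟩, rfl⟩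
        exact subset_clspan _ ⟨_, ⟨_, hΓ3 x hx y hy z hz, a, ha, rfl⟩, _, ⟨w, hw, rfl⟩, rfl⟩
      · refine comp_clspan_mem (T := P) ?_ heB
        rintro _ ⟨x, hx, y, hy, rfl⟩
        refine clspan_comp_mem (S := ΓA) (y := adjoint y) ?_ (hT x hx)
        exact fun s hs => subset_clspan _ ⟨s, hs, _, ⟨y, hy, rfl⟩, rfl⟩
    have hopen : IsOpen {S : K →L[ℂ] K | ∀ γ ∈ F, ‖(T - S) ∘L γ‖ < ε ∧
        ‖adjoint (T - S) ∘L γ‖ < ε} := by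
      simp only [Set.ofPred_forall]
      refine isOpen_biInter_finset fun γ _ => ?_
      have hsub : Continuous fun S : K →L[ℂ] K => T - S := continuous_const.sub continuous_id
      refine (isOpen_lt (hsub.clm_comp continuous_const).norm continuous_const).inter
        (isOpen_lt ((adjoint.continuous.comp hsub).clm_comp continuous_const).norm
          continuous_const)
    obtain ⟨S, hS, hSW⟩ := mem_closure_iff.1 heW _ hopen (fun γ hγ => by
      refine ⟨(he γ hγ).1, ?_⟩
      simpa [adjoint_comp, hadj, comp_assoc] using (he γ hγ).2)
    exact ⟨S, hSW, hS⟩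
  · intro h
    have hmem : ∀ S ∈ Submodule.span ℂ W, ∀ γ ∈ Γ,
        S ∘L γ ∈ clspan ΓA ∧ adjoint S ∘L γ ∈ clspan ΓA := by
      intro S hS γ hγ
      have hS' : S ∈ clspan W := (Submodule.span ℂ W).le_topologicalClosure hS
      constructor
      · refine clspan_comp_mem (S := W) ?_ hS'
        rintro _ ⟨_, ⟨x, hx, a, ha, rfl⟩, _, ⟨y, hy, rfl⟩, rfl⟩
        exact subset_clspan _ ⟨x, hx, _, hA3 a ha y hy γ hγ, rfl⟩
      · refine clspan_comp_mem (S := (fun S : K →L[ℂ] K => adjoint S) '' W) ?_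
          (adjoint_mem_clspan (S := W) (fun s hs => subset_clspan _ (Set.mem_image_of_mem _ hs)) hS')
        rintro _ ⟨_, ⟨_, ⟨x, hx, a, ha, rfl⟩, _, ⟨y, hy, rfl⟩, rfl⟩, rfl⟩
        exact subset_clspan _ ⟨y, hy, _, hA3 _ (hAstar a ha) x hx γ hγ, by
          simp [adjoint_comp, comp_assoc]⟩
    have happ : ∀ γ ∈ Γ, ∀ ε > 0, ∃ S ∈ Submodule.span ℂ W,
        ‖(T - S) ∘L γ‖ < ε ∧ ‖adjoint (T - S) ∘L γ‖ < ε := by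
      intro γ hγ ε hε
      obtain ⟨S, hS, hSF⟩ := h ε hε {γ} (by simpa using hγ)
      exact ⟨S, hS, hSF γ (by simp)⟩
    refine ⟨fun γ hγ => ?_, fun γ hγ => ?_⟩ <;>
      refine (isClosed_clspan ΓA).closure_subset (Metric.mem_closure_iff.2 fun ε hε => ?_) <;>
      obtain ⟨S, hS, h1, h2⟩ := happ γ hγ ε hε
    · exact ⟨S ∘L γ, (hmem S hS γ hγ).1, by simpa [dist_eq_norm, sub_comp] using h1⟩
    · exact ⟨adjoint S ∘L γ, (hmem S hS γ hγ).2, by simpa [dist_eq_norm, sub_comp] using h2⟩
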